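/- Let H₁ be an r₁-uniform hypergraph on n₁ vertices with α(H₁) < n₁/f and let H₂ be an r₂-uniform hypergraph on n₂ vertices with α(H₂) < n₂/g, where f ≥ 1 and g > 1 are real numbers. Set t = ⌈ log(n₁^{r₁−1} · f / r₁!) / log g ⌉ and h = (f/2)^{1/t}. Then the direct product H₁ □ H₂ is an (r₁·r₂)-uniform hypergraph on n₁·n₂ vertices with α(H₁ □ H₂) < n₁·n₂ / h. -/

import Mathlib

/-- The direct product of two hypergraphs: its edges are exactly the cartesian products
`E₁ ×ˢ E₂` of an edge `E₁` of `H₁` and an edge `E₂` of `H₂`. -/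
def DirectProd {V₁ V₂ : Type*} [DecidableEq V₁] [DecidableEq V₂]
    (H₁ : Finset (Finset V₁)) (H₂ : Finset (Finset V₂)) : Finset (Finset (V₁ × V₂)) :=
  Finset.image₂ (fun E₁ E₂ => E₁ ×ˢ E₂) H₁ H₂

/-- The independence number of `H` is (strictly) less than `x`. -/
def IndepLT {V : Type*} (H : Finset (Finset V)) (x : ℝ) : Prop :=
  ∀ S : Finset V, (∀ e ∈ H, ¬ e ⊆ S) → (S.card : ℝ) < x

/-- Removing one vertex from every edge inside `I` leaves an independent set. -/
lemma removal {V : Type*} [DecidableEq V] (H : Finset (Finset V)) (x : ℝ)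
    (hne : ∀ e ∈ H, e.Nonempty) (hx : IndepLT H x) (I : Finset V) :
    (I.card : ℝ) < x + ((H.filter (fun e => e ⊆ I)).card : ℝ) := by
  classical
  choose p hp using hne
  let R : Finset V := H.attach.biUnion (fun e => if e.1 ⊆ I then {p e.1 e.2} else ∅)
  have hR : R.card ≤ (H.filter (fun e => e ⊆ I)).card := by
    calc R.card ≤ ∑ e ∈ H.attach, (if e.1 ⊆ I then ({p e.1 e.2} : Finset V) else ∅).card :=
          Finset.card_biUnion_le
      _ = ∑ e ∈ H.attach, (if e.1 ⊆ I then 1 else 0) := by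
          refine Finset.sum_congr rfl fun e _ => ?_
          split_ifs <;> simp
      _ = ∑ e ∈ H, (if e ⊆ I then 1 else 0) :=
          Finset.sum_attach H (fun e => if e ⊆ I then 1 else 0)
      _ = _ := by rw [Finset.card_filter]
  have h1 := hx (I \ R) (by
    intro e he hsub
    have hI : e ⊆ I := hsub.trans Finset.sdiff_subset
    have h2 := hsub (hp e he)
    rw [Finset.mem_sdiff] at h2
    apply h2.2
    refine Finset.mem_biUnion.2 ⟨⟨e, he⟩, Finset.mem_attach _ _, ?_⟩
    simp [hI])
  have h3 : I.card ≤ (I \ R).card + R.card := by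
    have := Finset.le_card_sdiff R I
    omega
  have h4 : (I.card : ℝ) ≤ (I \ R).card + (H.filter (fun e => e ⊆ I)).card := by
    exact_mod_cast h3.trans (by omega)
  linarith

/-- Double counting: tuples. -/
lemma tuple_count {A V : Type*} [Fintype V] [DecidableEq V] (t : ℕ) (s : Finset A)
    (P : A → V → Prop) [∀ a, DecidablePred (P a)] :
    ∑ φ : Fin t → V, (s.filter (fun a => ∀ i, P a (φ i))).card
      = ∑ a ∈ s, (Finset.univ.filter (P a)).card ^ t := by
  classical
  simp_rw [Finset.card_filter]
  rw [Finset.sum_comm]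
  refine Finset.sum_congr rfl fun a _ => ?_
  rw [← Finset.card_filter, ← Finset.card_filter, ← Fintype.card_piFinset_const]
  congr 1
  ext φ
  simp [Fintype.mem_piFinset]

lemma mainCore (n₁ n₂ r k : ℕ) (f g h : ℝ) (hf : 1 ≤ f) (hg : 1 < g) (hh : 0 < h)
    (hn₁ : 0 < n₁) (hn₂ : 0 < n₂) (hr : 0 < r)
    (H₁ : Finset (Finset (Fin n₁))) (H₂ : Finset (Finset (Fin n₂)))
    (h₁ : ∀ e ∈ H₁, e.card = r)
    (hα₁ : IndepLT H₁ ((n₁ : ℝ) / f)) (hα₂ : IndepLT H₂ ((n₂ : ℝ) / g))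
    (hpow : h ^ (k + 1) = f / 2)
    (ht : (n₁ : ℝ) ^ (r - 1) * f / (Nat.factorial r : ℝ) ≤ g ^ (k + 1)) :
    IndepLT (DirectProd H₁ H₂) ((n₁ : ℝ) * (n₂ : ℝ) / h) := by
  classical
  intro S hS
  by_contra hcon
  push Not at hcon
  have hN₁ : (0 : ℝ) < n₁ := by exact_mod_cast hn₁
  have hN₂ : (0 : ℝ) < n₂ := by exact_mod_cast hn₂
  let I : (Fin (k + 1) → Fin n₂) → Finset (Fin n₁) :=
    fun φ => Finset.univ.filter (fun u => ∀ i, (u, φ i) ∈ S)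
  let d : Fin n₁ → ℕ := fun u => (Finset.univ.filter (fun v : Fin n₂ => (u, v) ∈ S)).card
  let c : Finset (Fin n₁) → ℕ :=
    fun e => (Finset.univ.filter (fun v : Fin n₂ => ∀ u ∈ e, (u, v) ∈ S)).card
  have hI : ∀ φ, ((I φ).card : ℝ) < n₁ / f + ((H₁.filter (fun e => e ⊆ I φ)).card : ℝ) :=
    fun φ => removal H₁ _ (fun e he => Finset.card_pos.1 (by rw [h₁ e he]; exact hr)) hα₁ (I φ)
  have hne : (Finset.univ : Finset (Fin (k + 1) → Fin n₂)).Nonempty :=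
    ⟨fun _ => ⟨0, hn₂⟩, Finset.mem_univ _⟩
  have hsum := Finset.sum_lt_sum_of_nonempty hne (fun φ _ => hI φ)
  rw [Finset.sum_add_distrib, Finset.sum_const, Finset.card_univ, Fintype.card_fun,
    Fintype.card_fin, Fintype.card_fin, nsmul_eq_mul] at hsum
  have e1 : ∑ φ, ((I φ).card : ℝ) = ∑ u, (d u : ℝ) ^ (k + 1) := by
    exact_mod_cast tuple_count (k + 1) Finset.univ (fun (u : Fin n₁) (v : Fin n₂) => (u, v) ∈ S)
  have e2 : ∑ φ, ((H₁.filter (fun e => e ⊆ I φ)).card : ℝ) = ∑ e ∈ H₁, (c e : ℝ) ^ (k + 1) := by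
    have := tuple_count (k + 1) H₁ (fun e (v : Fin n₂) => ∀ u ∈ e, (u, v) ∈ S)
    have h3 : ∀ φ, H₁.filter (fun e => e ⊆ I φ)
        = H₁.filter (fun e => ∀ i, ∀ u ∈ e, (u, φ i) ∈ S) := by
      intro φ
      refine Finset.filter_congr fun e _ => ?_
      simp only [I, Finset.subset_iff, Finset.mem_filter, Finset.mem_univ, true_and]
      exact ⟨fun h i u hu => h hu i, fun h u hu i => h i u hu⟩
    simp_rw [h3]
    exact_mod_cast this
  rw [e1, e2] at hsum
  have hc : ∀ e ∈ H₁, (c e : ℝ) ^ (k + 1) ≤ (n₂ / g) ^ (k + 1) := by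
    intro e he
    refine pow_le_pow_left₀ (by positivity) (le_of_lt (hα₂ _ ?_)) _
    intro e' he' hsub
    refine hS (e ×ˢ e') (Finset.mem_image₂_of_mem he he') ?_
    rintro ⟨u, v⟩ huv
    rw [Finset.mem_product] at huv
    exact (Finset.mem_filter.1 (hsub huv.2)).2 u huv.1
  have hcs : ∑ e ∈ H₁, (c e : ℝ) ^ (k + 1) ≤ H₁.card * (n₂ / g) ^ (k + 1) := by
    have := Finset.sum_le_sum hc
    rwa [Finset.sum_const, nsmul_eq_mul] at this
  have hcard : (H₁.card : ℝ) ≤ (n₁ : ℝ) ^ r / (Nat.factorial r : ℝ) := by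
    have h3 : H₁.card ≤ n₁.choose r := by
      have : H₁ ⊆ Finset.powersetCard r Finset.univ := fun e he =>
        Finset.mem_powersetCard.2 ⟨Finset.subset_univ _, h₁ e he⟩
      simpa using Finset.card_le_card this
    exact le_trans (by exact_mod_cast h3) (Nat.choose_le_pow_div r n₁)
  have hd : ∑ u, (d u : ℝ) = S.card := by
    have : ∑ u, d u = S.card := by
      rw [Finset.card_eq_sum_card_fiberwise (f := Prod.fst) (t := Finset.univ) (by simp)]
      refine Finset.sum_congr rfl fun u _ => ?_
      refine Finset.card_bij (fun v _ => (u, v)) ?_ ?_ ?_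
      · intro v hv; simpa using hv
      · intro v _ w _ h; simpa using h
      · rintro ⟨a, b⟩ hab
        simp only [Finset.mem_filter] at hab
        obtain ⟨h1, rfl⟩ := hab
        exact ⟨b, by simpa using h1, rfl⟩
    exact_mod_cast this
  have hpm := pow_sum_div_card_le_sum_pow (s := (Finset.univ : Finset (Fin n₁)))
    (f := fun u => (d u : ℝ)) (fun u _ => by positivity) k
  rw [hd, Finset.card_univ, Fintype.card_fin] at hpm
  have hf0 : 0 < f := by linarith
  have hg0 : 0 < g := by linarith
  have hlow : 2 * ((n₁ : ℝ) * (n₂ : ℝ) ^ (k + 1) / f) ≤ (S.card : ℝ) ^ (k + 1) / (n₁ : ℝ) ^ k := by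
    have h3 := pow_le_pow_left₀ (by positivity) hcon (k + 1)
    rw [div_pow, hpow, mul_pow] at h3
    rw [le_div_iff₀ (by positivity)]
    refine le_trans (le_of_eq ?_) h3
    field_simp
    ring
  have hup : (H₁.card : ℝ) * (n₂ / g) ^ (k + 1) ≤ (n₁ : ℝ) * (n₂ : ℝ) ^ (k + 1) / f := by
    have h3 : (H₁.card : ℝ) * f ≤ n₁ * g ^ (k + 1) := by
      calc (H₁.card : ℝ) * f ≤ (n₁ : ℝ) ^ r / (Nat.factorial r : ℝ) * f := by gcongr
        _ = n₁ * ((n₁ : ℝ) ^ (r - 1) * f / (Nat.factorial r : ℝ)) := by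
            rw [← Nat.succ_pred_eq_of_pos hr]
            simp only [Nat.succ_eq_add_one, Nat.add_sub_cancel, pow_succ]
            ring
        _ ≤ _ := by gcongr
    rw [div_pow, le_div_iff₀ hf0, mul_div_assoc', div_mul_eq_mul_div,
      div_le_iff₀ (by positivity)]
    have h4 := mul_le_mul_of_nonneg_right h3 (by positivity : (0 : ℝ) ≤ (n₂ : ℝ) ^ (k + 1))
    linarith
  have h6 : ((n₂ ^ (k + 1) : ℕ) : ℝ) * ((n₁ : ℝ) / f) = (n₁ : ℝ) * (n₂ : ℝ) ^ (k + 1) / f := by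
    push_cast
    ring
  rw [h6] at hsum
  linarith

lemma factorial_succ_le (m : ℕ) : (m + 1).factorial ≤ (m + 1) ^ m := by
  induction m with
  | zero => simp
  | succ m ih =>
    rw [Nat.factorial_succ, pow_succ, mul_comm]
    exact Nat.mul_le_mul_right _ (ih.trans (Nat.pow_le_pow_left (by omega) _))

theorem stmt7 (n₁ n₂ r₁ r₂ : ℕ) (f g : ℝ) (hf : 1 ≤ f) (hg : 1 < g)
    (H₁ : Finset (Finset (Fin n₁))) (H₂ : Finset (Finset (Fin n₂)))
    (h₁ : ∀ e ∈ H₁, e.card = r₁) (h₂ : ∀ e ∈ H₂, e.card = r₂)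
    (hα₁ : IndepLT H₁ ((n₁ : ℝ) / f)) (hα₂ : IndepLT H₂ ((n₂ : ℝ) / g)) :
    ∀ t : ℤ, t = ⌈Real.log ((n₁ : ℝ) ^ (r₁ - 1) * f / (Nat.factorial r₁ : ℝ)) / Real.log g⌉ →
    ∀ h : ℝ, h = (f / 2) ^ ((1 : ℝ) / (t : ℝ)) →
      (∀ e ∈ DirectProd H₁ H₂, e.card = r₁ * r₂) ∧
      Nat.card (Fin n₁ × Fin n₂) = n₁ * n₂ ∧
      IndepLT (DirectProd H₁ H₂) ((n₁ : ℝ) * (n₂ : ℝ) / h) := by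
  intro t ht h hh
  refine ⟨?_, by simp, ?_⟩
  · intro e he
    obtain ⟨a, ha, b, hb, rfl⟩ := Finset.mem_image₂.1 he
    rw [Finset.card_product, h₁ a ha, h₂ b hb]
  have hne₁ : H₁.Nonempty := by
    by_contra hcon
    rw [Finset.not_nonempty_iff_eq_empty] at hcon
    have := hα₁ Finset.univ (by simp [hcon])
    rw [Finset.card_univ, Fintype.card_fin] at this
    exact absurd this (not_lt.2 (div_le_self (by positivity) hf))
  have hne₂ : H₂.Nonempty := by
    by_contra hcon
    rw [Finset.not_nonempty_iff_eq_empty] at hcon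
    have := hα₂ Finset.univ (by simp [hcon])
    rw [Finset.card_univ, Fintype.card_fin] at this
    exact absurd this (not_lt.2 (div_le_self (by positivity) hg.le))
  obtain ⟨a, ha⟩ := hne₁
  obtain ⟨b, hb⟩ := hne₂
  have hab : a ×ˢ b ∈ DirectProd H₁ H₂ := Finset.mem_image₂_of_mem ha hb
  rcases Nat.eq_zero_or_pos r₁ with hr₁ | hr₁
  · intro S hS
    have : a = ∅ := Finset.card_eq_zero.1 (by rw [h₁ a ha, hr₁])
    exact absurd (by simp [this]) (hS _ hab)
  rcases Nat.eq_zero_or_pos r₂ with hr₂ | hr₂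
  · intro S hS
    have : b = ∅ := Finset.card_eq_zero.1 (by rw [h₂ b hb, hr₂])
    exact absurd (by simp [this]) (hS _ hab)
  have hrn₁ : r₁ ≤ n₁ := by
    rw [← h₁ a ha]; simpa using Finset.card_le_univ a
  have hrn₂ : r₂ ≤ n₂ := by
    rw [← h₂ b hb]; simpa using Finset.card_le_univ b
  have hlg : 0 < Real.log g := Real.log_pos hg
  have hfac : (1 : ℝ) ≤ (n₁ : ℝ) ^ (r₁ - 1) * f / (Nat.factorial r₁ : ℝ) := by
    rw [one_le_div (by positivity)]
    have h3 : Nat.factorial r₁ ≤ n₁ ^ (r₁ - 1) := by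
      obtain ⟨m, rfl⟩ : ∃ m, r₁ = m + 1 := ⟨r₁ - 1, by omega⟩
      calc (m + 1).factorial ≤ (m + 1) ^ m := factorial_succ_le m
        _ ≤ _ := Nat.pow_le_pow_left hrn₁ _
    have h4 : (Nat.factorial r₁ : ℝ) ≤ (n₁ : ℝ) ^ (r₁ - 1) := by exact_mod_cast h3
    exact h4.trans (le_mul_of_one_le_right (by positivity) hf)
  have ht0 : 0 ≤ t := by
    rw [ht]
    exact Int.ceil_nonneg (div_nonneg (Real.log_nonneg hfac) hlg.le)
  obtain ⟨m, rfl⟩ := Int.eq_ofNat_of_zero_le ht0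
  rcases m with _ | k
  · have hh1 : h = 1 := by rw [hh]; simp
    intro S hS
    rw [hh1, div_one]
    have hlt : S.card < n₁ * n₂ := by
      have : S ⊂ Finset.univ := by
        rw [Finset.ssubset_univ_iff]
        rintro rfl
        exact hS _ hab (Finset.subset_univ _)
      simpa using Finset.card_lt_card this
    exact_mod_cast hlt
  have hf2 : 0 < f / 2 := by linarith
  refine mainCore n₁ n₂ r₁ k f g h hf hg (by rw [hh]; positivity) (by omega) (by omega) hr₁ H₁ H₂
    h₁ hα₁ hα₂ ?_ ?_
  · rw [hh, ← Real.rpow_natCast, ← Real.rpow_mul hf2.le]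
    have : (1 : ℝ) / ((((k + 1 : ℕ) : ℤ)) : ℝ) * ((k + 1 : ℕ) : ℝ) = 1 := by
      push_cast
      field_simp
    rw [this, Real.rpow_one]
  · have h5 := Int.le_ceil (Real.log ((n₁ : ℝ) ^ (r₁ - 1) * f / (Nat.factorial r₁ : ℝ)) / Real.log g)
    rw [← ht, div_le_iff₀ hlg] at h5
    rw [← Real.log_le_log_iff (by linarith) (by positivity), Real.log_pow]
    exact_mod_cast h5
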